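/- arXiv:1302.1835 — 3 statements merged into one kernel-verified Lean document; each statement's English description precedes it below -/
import Mathlib

section
/- Let Q be a finite quiver over F_q, let E be a finite-dimensional representation of Q, and let n ≥ 0. Then for every dimension vector α, Σ_{β+γ=α} q^{−⟨γ,β⟩} · (|Rep_γ(Q)|/|GL_γ|) · |Gr^β(nE)| = Σ_{M ∈ Rep_α(Q)} |Hom_Q(nE, M)| / |GL_α|. -/
/-- A finite quiver: finite sets of vertices and arrows, with source and target maps. -/
structure FinQuiver where
  V : Type
  A : Type
  [fV : Fintype V]
  [fA : Fintype A]
  [dV : DecidableEq V]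
  s : A → V
  t : A → V

attribute [instance] FinQuiver.fV FinQuiver.fA FinQuiver.dV

variable (F : Type) [Field F] (Q : FinQuiver)

/-- A representation of the quiver `Q` over `F`. -/
structure QRep where
  space : Q.V → Type
  [acg : ∀ v, AddCommGroup (space v)]
  [mod : ∀ v, Module F (space v)]
  map : ∀ a : Q.A, space (Q.s a) →ₗ[F] space (Q.t a)

attribute [instance] QRep.acg QRep.mod

variable {F Q}

/-- The space `Rep_α(Q)` of `α`-dimensional representations on the standard spaces. -/
def RepSpace (α : Q.V → ℕ) : Type :=
  ∀ a : Q.A, (Fin (α (Q.s a)) → F) →ₗ[F] (Fin (α (Q.t a)) → F)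

/-- The representation corresponding to a point of `Rep_α(Q)`. -/
def RepSpace.toQRep {α : Q.V → ℕ} (M : RepSpace (F := F) (Q := Q) α) : QRep F Q where
  space v := Fin (α v) → F
  map := M

/-- Morphisms of representations of `Q`. -/
def HomRep (X Y : QRep F Q) : Type :=
  {f : ∀ v, X.space v →ₗ[F] Y.space v //
    ∀ a : Q.A, (f (Q.t a)).comp (X.map a) = (Y.map a).comp (f (Q.s a))}

/-- The direct sum `nE` of `n` copies of a representation `E`. -/
def nCopies (n : ℕ) (E : QRep F Q) : QRep F Q where
  space v := Fin n → E.space v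
  map a := LinearMap.pi fun i => (E.map a).comp (LinearMap.proj i)

/-- Subrepresentations of a representation `E`. -/
def SubRep (E : QRep F Q) : Type :=
  {L : ∀ v, Submodule F (E.space v) //
    ∀ a : Q.A, (L (Q.s a)).map (E.map a) ≤ L (Q.t a)}

/-- The dimension vector of a subrepresentation. -/
noncomputable def SubRep.dim {E : QRep F Q} (L : SubRep E) (v : Q.V) : ℕ :=
  Module.finrank F (L.1 v)

/-- The (additive) Euler form of `Q`, valued in `ℤ`. -/
def eulerInt (γ β : Q.V → ℕ) : ℤ :=
  (∑ v, (γ v : ℤ) * (β v)) - ∑ a : Q.A, (γ (Q.s a) : ℤ) * (β (Q.t a))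

/-- `|GL_α| = ∏_v |GL_{α(v)}(F)|`. -/
noncomputable def glCard [Fintype F] (α : Q.V → ℕ) : ℚ :=
  ∏ v, (Nat.card (GL (Fin (α v)) F) : ℚ)



section helpers

theorem aux_cardExt [Fintype F] {X W U : Type} [AddCommGroup X] [Module F X]
    [AddCommGroup W] [Module F W] [AddCommGroup U] [Module F U] [Module.Finite F W]
    [Module.Finite F U]
    (f : X →ₗ[F] W) (g : X →ₗ[F] U) (h : LinearMap.ker f ≤ LinearMap.ker g) :
    Nat.card {m : W →ₗ[F] U // g = m.comp f} =
      Fintype.card F ^ ((Module.finrank F W - Module.finrank F (X ⧸ LinearMap.ker f))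
        * Module.finrank F U) := by
  obtain ⟨m0, hm0⟩ : ∃ m0 : W →ₗ[F] U, g = m0.comp f := by
    obtain ⟨m, hm⟩ := LinearMap.exists_extend
      (((LinearMap.ker f).liftQ g h).comp f.quotKerEquivRange.symm.toLinearMap)
    refine ⟨m, ?_⟩
    ext x
    have := LinearMap.congr_fun hm ⟨f x, LinearMap.mem_range_self f x⟩
    have e : f.quotKerEquivRange.symm ⟨f x, LinearMap.mem_range_self f x⟩
        = (LinearMap.ker f).mkQ x := by
      rw [LinearEquiv.symm_apply_eq]; rfl
    simp only [LinearMap.comp_apply, LinearEquiv.coe_coe, e] at this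
    simpa using this.symm
  have e : {m : W →ₗ[F] U // g = m.comp f} ≃ ((W ⧸ LinearMap.range f) →ₗ[F] U) :=
    { toFun := fun m => (LinearMap.range f).liftQ (m.1 - m0) (by
        rintro _ ⟨x, rfl⟩
        have h1 := LinearMap.congr_fun m.2 x
        have h2 := LinearMap.congr_fun hm0 x
        simp only [LinearMap.comp_apply] at h1 h2
        simp [← h1, ← h2])
      invFun := fun m => ⟨m0 + m.comp (LinearMap.range f).mkQ, by
        ext x
        have h2 := LinearMap.congr_fun hm0 x
        have h3 : (LinearMap.range f).mkQ (f x) = 0 := by simp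
        simp only [LinearMap.comp_apply, LinearMap.add_apply] at h2 ⊢
        rw [h3, h2]; simp⟩
      left_inv := fun m => by
        apply Subtype.ext
        ext x
        simp
      right_inv := fun m => by
        ext x
        simp }
  rw [Nat.card_congr e, Module.natCard_eq_pow_finrank (K := F), Module.finrank_linearMap,
    Nat.card_eq_fintype_card, f.quotKerEquivRange.finrank_eq, Submodule.finrank_quotient]

theorem aux_cardKer [Fintype F] {X W : Type} [AddCommGroup X] [Module F X]
    [AddCommGroup W] [Module F W] [Module.Finite F X] (L : Submodule F X) :
    Nat.card {f : X →ₗ[F] W // LinearMap.ker f = L} =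
      Nat.card {s : Fin (Module.finrank F (X ⧸ L)) → W // LinearIndependent F s} := by
  let b := Module.finBasis F (X ⧸ L)
  have e1 : {f : X →ₗ[F] W // LinearMap.ker f = L} ≃
      {g : (X ⧸ L) →ₗ[F] W // LinearMap.ker g = ⊥} :=
    { toFun := fun f => ⟨L.liftQ f.1 f.2.ge, by
        rw [Submodule.ker_liftQ, f.2, Submodule.mkQ_map_self]⟩
      invFun := fun g => ⟨g.1.comp L.mkQ, by
        rw [LinearMap.ker_comp, g.2]; simp⟩
      left_inv := fun f => by
        apply Subtype.ext; ext x; simp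
      right_inv := fun g => by
        apply Subtype.ext; ext x; simp }
  have e2 : {g : (X ⧸ L) →ₗ[F] W // LinearMap.ker g = ⊥} ≃
      {s : Fin (Module.finrank F (X ⧸ L)) → W // LinearIndependent F s} :=
    ((b.constr F).toEquiv.subtypeEquiv (fun s => by
      constructor
      · intro hs
        rw [LinearMap.ker_eq_bot']
        intro x hx
        replace hx : (b.constr F s) x = 0 := hx
        rw [b.constr_apply_fintype F] at hx
        have := (Fintype.linearIndependent_iff.1 hs) _ hx
        apply b.equivFun.injective
        ext i
        simpa using this i
      · intro hs
        have := b.linearIndependent.map' _ hs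
        have h2 : (⇑((b.constr F).toEquiv s) ∘ ⇑b) = s := by
          funext i
          exact b.constr_basis F s i
        rw [h2] at this
        exact this)).symm
  exact Nat.card_congr (e1.trans e2)

theorem aux_GL [Fintype F] (a b : ℕ) (h : b ≤ a) :
    Nat.card (GL (Fin a) F) =
      Nat.card {s : Fin b → (Fin a → F) // LinearIndependent F s} *
        (Fintype.card F ^ ((a - b) * b) * Nat.card (GL (Fin (a - b)) F)) := by
  obtain ⟨c, rfl⟩ := Nat.exists_eq_add_of_le h
  rw [Nat.add_sub_cancel_left]
  rw [Matrix.card_GL_field, Matrix.card_GL_field, card_linearIndependent (by simpa using h)]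
  simp only [Module.finrank_fin_fun]
  rw [Fin.prod_univ_add]
  congr 1
  rw [pow_mul', ← Fin.prod_const c, ← Finset.prod_mul_distrib]
  refine Finset.prod_congr rfl fun i _ => ?_
  simp only [Fin.val_natAdd]
  rw [Nat.mul_sub, pow_add, pow_add]

theorem aux_zero [Fintype F] (a b : ℕ) (h : ¬ b ≤ a) :
    Nat.card {s : Fin b → (Fin a → F) // LinearIndependent F s} = 0 := by
  have : IsEmpty {s : Fin b → (Fin a → F) // LinearIndependent F s} :=
    ⟨fun s => h (by simpa using s.2.fintype_card_le_finrank)⟩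
  exact Nat.card_of_isEmpty

def auxEquiv (X : QRep F Q) (α : Q.V → ℕ) :
    ((M : RepSpace (F := F) (Q := Q) α) × HomRep X M.toQRep) ≃
      (L : SubRep X) × (f : {f : ∀ v, X.space v →ₗ[F] (Fin (α v) → F) //
          ∀ v, LinearMap.ker (f v) = L.1 v}) ×
        {M : ∀ a : Q.A, (Fin (α (Q.s a)) → F) →ₗ[F] (Fin (α (Q.t a)) → F) //
          ∀ a, (f.1 (Q.t a)).comp (X.map a) = (M a).comp (f.1 (Q.s a))} where
  toFun p := ⟨⟨fun v => LinearMap.ker (p.2.1 v), by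
      intro a
      rintro _ ⟨x, hx, rfl⟩
      have h := LinearMap.congr_fun (p.2.2 a) x
      have hx' : (p.2.1 (Q.s a)) x = 0 := hx
      simp only [LinearMap.comp_apply, hx', map_zero] at h
      exact h⟩, ⟨p.2.1, fun _ => rfl⟩, ⟨p.1, p.2.2⟩⟩
  invFun p := ⟨p.2.2.1, ⟨p.2.1.1, p.2.2.2⟩⟩
  left_inv p := rfl
  right_inv p := by
    obtain ⟨⟨L, hL⟩, ⟨f, hf⟩, M⟩ := p
    obtain rfl : (fun v => LinearMap.ker (f v)) = L := funext hf
    rfl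

theorem aux_count [Fintype F] (X : QRep F Q) [∀ v, Module.Finite F (X.space v)] (α : Q.V → ℕ)
    [Fintype (SubRep X)] :
    Nat.card ((M : RepSpace (F := F) (Q := Q) α) × HomRep X M.toQRep) =
      ∑ L : SubRep X,
        (∏ v, Nat.card {s : Fin (Module.finrank F (X.space v ⧸ L.1 v)) → (Fin (α v) → F) //
          LinearIndependent F s}) *
        ∏ a, Fintype.card F ^ ((α (Q.s a) - Module.finrank F (X.space (Q.s a) ⧸ L.1 (Q.s a)))
          * α (Q.t a)) := by
  classical
  have fX : ∀ v, Finite (X.space v) := fun v => Module.finite_of_finite F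
  have fH : ∀ v, Finite (X.space v →ₗ[F] (Fin (α v) → F)) := fun v => Module.finite_of_finite F
  have fM : ∀ a, Finite ((Fin (α (Q.s a)) → F) →ₗ[F] (Fin (α (Q.t a)) → F)) :=
    fun v => Module.finite_of_finite F
  rw [Nat.card_congr (auxEquiv X α), Nat.card_sigma]
  refine Finset.sum_congr rfl fun L _ => ?_
  have := Fintype.ofFinite {f : ∀ v, X.space v →ₗ[F] (Fin (α v) → F) //
          ∀ v, LinearMap.ker (f v) = L.1 v}
  rw [Nat.card_sigma]
  have key : ∀ f : {f : ∀ v, X.space v →ₗ[F] (Fin (α v) → F) //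
          ∀ v, LinearMap.ker (f v) = L.1 v}, Nat.card 
        {M : ∀ a : Q.A, (Fin (α (Q.s a)) → F) →ₗ[F] (Fin (α (Q.t a)) → F) //
          ∀ a, (f.1 (Q.t a)).comp (X.map a) = (M a).comp (f.1 (Q.s a))} = 
        ∏ a, Fintype.card F ^ ((α (Q.s a) - Module.finrank F (X.space (Q.s a) ⧸ L.1 (Q.s a)))
          * α (Q.t a)) := by
    rintro ⟨f, hf⟩
    rw [Nat.card_congr (Equiv.subtypePiEquivPi (p := fun a M =>
      (f (Q.t a)).comp (X.map a) = LinearMap.comp M (f (Q.s a)))), Nat.card_pi]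
    refine Finset.prod_congr rfl fun a _ => ?_
    rw [aux_cardExt, hf]
    · simp
    · intro x hx
      rw [hf] at hx
      rw [LinearMap.mem_ker, LinearMap.comp_apply, ← LinearMap.mem_ker, hf]
      exact L.2 a ⟨x, hx, rfl⟩
  simp only [key]
  rw [Finset.sum_const, smul_eq_mul, Finset.card_univ, ← Nat.card_eq_fintype_card,
    Nat.card_congr (Equiv.subtypePiEquivPi (p := fun v (f : X.space v →ₗ[F] (Fin (α v) → F)) =>
      LinearMap.ker f = L.1 v)), Nat.card_pi]
  simp only [aux_cardKer]

theorem aux_term [Fintype F] (α β : Q.V → ℕ) (h : β ≤ α) :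
    ((Fintype.card F : ℚ) ^ (-(eulerInt (Q := Q) (α - β) β))) *
          ((Nat.card (RepSpace (F := F) (Q := Q) (α - β)) : ℚ) / glCard (F := F) (α - β)) =
    (((∏ v, Nat.card {s : Fin (β v) → (Fin (α v) → F) // LinearIndependent F s}) *
        ∏ a, Fintype.card F ^ ((α (Q.s a) - β (Q.s a)) * α (Q.t a)) : ℕ) : ℚ) /
      glCard (F := F) α := by
  have hq : (Fintype.card F : ℚ) ≠ 0 := by simp
  have hgl : ∀ γ : Q.V → ℕ, glCard (F := F) γ ≠ 0 := fun γ =>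
    Finset.prod_ne_zero_iff.2 fun v _ => by
      exact_mod_cast Nat.card_pos.ne'
  have h1 : glCard (F := F) α =
      (∏ v, (Nat.card {s : Fin (β v) → (Fin (α v) → F) // LinearIndependent F s} : ℚ)) *
       ((Fintype.card F : ℚ) ^ (∑ v, (α v - β v) * β v) * glCard (F := F) (α - β)) := by
    unfold glCard
    rw [← Finset.prod_pow_eq_pow_sum, ← Finset.prod_mul_distrib, ← Finset.prod_mul_distrib]
    refine Finset.prod_congr rfl fun v _ => ?_
    rw [aux_GL (α v) (β v) (h v)]
    push_cast
    rfl
  have h2 : Nat.card (RepSpace (F := F) (Q := Q) (α - β)) =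
      Fintype.card F ^ (∑ a, (α (Q.s a) - β (Q.s a)) * (α (Q.t a) - β (Q.t a))) := by
    unfold RepSpace
    rw [Nat.card_pi, ← Finset.prod_pow_eq_pow_sum]
    refine Finset.prod_congr rfl fun a _ => ?_
    rw [Module.natCard_eq_pow_finrank (K := F), Module.finrank_linearMap]
    simp
  have h3 : (Fintype.card F : ℚ) ^ (-(eulerInt (Q := Q) (α - β) β)) =
      (Fintype.card F : ℚ) ^ (∑ a, (α (Q.s a) - β (Q.s a)) * β (Q.t a)) /
      (Fintype.card F : ℚ) ^ (∑ v, (α v - β v) * β v) := by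
    rw [← zpow_natCast, ← zpow_natCast, ← zpow_sub₀ hq]
    congr 1
    unfold eulerInt
    push_cast
    simp
  have h4 : ∑ a, (α (Q.s a) - β (Q.s a)) * α (Q.t a) =
      ∑ a, (α (Q.s a) - β (Q.s a)) * β (Q.t a) +
      ∑ a, (α (Q.s a) - β (Q.s a)) * (α (Q.t a) - β (Q.t a)) := by
    rw [← Finset.sum_add_distrib]
    refine Finset.sum_congr rfl fun a _ => ?_
    rw [← mul_add, Nat.add_sub_cancel' (h _)]
  have h5 := hgl α
  have h6 := hgl (α - β)
  rw [h3, h2, Finset.prod_pow_eq_pow_sum, h4, pow_add]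
  rw [h1] at h5 ⊢
  push_cast
  have h7 := left_ne_zero_of_mul h5
  field_simp

end helpers

/-- Lemma 5.2 of the paper: for a finite quiver `Q` over `F_q`, a finite-dimensional
representation `E` and `n ≥ 0`, one has
`Σ_{β+γ=α} q^{−⟨γ,β⟩} (|Rep_γ(Q)|/|GL_γ|) |Gr^β(nE)| = Σ_{M ∈ Rep_α(Q)} |Hom_Q(nE,M)| / |GL_α|`,
where `Gr^β(nE)` is the set of subrepresentations of `nE` of codimension vector `β`
(i.e. with `β`-dimensional quotient), and `⟨−,−⟩` is the Euler form of `Q`. -/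
theorem stmt13 [Fintype F] (q : ℕ) (hq : Fintype.card F = q)
    (E : QRep F Q) [∀ v, Module.Finite F (E.space v)] (n : ℕ) (α : Q.V → ℕ) :
    ∑ β ∈ Finset.Iic α,
        ((q : ℚ) ^ (-(eulerInt (Q := Q) (α - β) β))) *
          ((Nat.card (RepSpace (F := F) (Q := Q) (α - β)) : ℚ) / glCard (F := F) (α - β)) *
          (Nat.card {L : SubRep (nCopies n E) //
            ∀ v, Module.finrank F ((nCopies n E).space v) = L.dim v + β v} : ℚ) =
      (Nat.card ((M : RepSpace (F := F) (Q := Q) α) ×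
        HomRep (nCopies n E) M.toQRep) : ℚ) / glCard (F := F) α := by
  classical
  subst hq
  have iX : ∀ v, Module.Finite F ((nCopies n E).space v) := fun v =>
    inferInstanceAs (Module.Finite F (Fin n → E.space v))
  generalize nCopies n E = X at iX ⊢
  have fX : ∀ v, Finite (X.space v) := fun v => Module.finite_of_finite F
  have fS : Finite (SubRep X) := inferInstanceAs (Finite {L : ∀ v, Submodule F (X.space v) //
    ∀ a : Q.A, (L (Q.s a)).map (X.map a) ≤ L (Q.t a)})
  have := Fintype.ofFinite (SubRep X)
  let cd : SubRep X → Q.V → ℕ := fun L v => Module.finrank F (X.space v ⧸ L.1 v)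
  let T : (Q.V → ℕ) → ℕ := fun β =>
    (∏ v, Nat.card {s : Fin (β v) → (Fin (α v) → F) // LinearIndependent F s}) *
        ∏ a, Fintype.card F ^ ((α (Q.s a) - β (Q.s a)) * α (Q.t a))
  have hc : Nat.card ((M : RepSpace (F := F) (Q := Q) α) × HomRep X M.toQRep) =
      ∑ L : SubRep X, T (cd L) := aux_count X α
  have h0 : ∑ L : SubRep X, T (cd L) = ∑ L : SubRep X with cd L ≤ α, T (cd L) := by
    symm
    apply Finset.sum_subset (Finset.subset_univ _)
    intro L _ hL
    simp only [Finset.mem_filter, Finset.mem_univ, true_and, Pi.le_def, not_forall] at hL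
    obtain ⟨v, hv⟩ := hL
    exact mul_eq_zero_of_left (Finset.prod_eq_zero (Finset.mem_univ v) (aux_zero _ _ hv)) _
  rw [hc, h0, ← Finset.sum_fiberwise_of_maps_to (t := Finset.Iic α) (g := cd)
    (by intro L hL; simpa using hL), Nat.cast_sum, Finset.sum_div]
  refine Finset.sum_congr rfl fun β hβ => ?_
  rw [Finset.mem_Iic] at hβ
  rw [aux_term α β hβ]
  have h1 : ∑ L ∈ Finset.univ.filter (fun L : SubRep X => cd L ≤ α) with cd L = β, T (cd L) =
      Nat.card {L : SubRep X // ∀ v, Module.finrank F (X.space v) = L.dim v + β v} * T β := by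
    rw [Finset.sum_congr rfl (g := fun _ => T β)
      (by intro L hL; rw [(Finset.mem_filter.1 hL).2]), Finset.sum_const, smul_eq_mul]
    congr 1
    rw [Nat.card_eq_fintype_card, Fintype.card_subtype]
    congr 1
    ext L
    simp only [Finset.mem_filter, Finset.mem_univ, true_and]
    have hL : cd L = β ↔ ∀ v, Module.finrank F (X.space v) = L.dim v + β v := by
      rw [funext_iff]
      refine forall_congr' fun v => ?_
      have := Submodule.finrank_quotient_add_finrank (L.1 v)
      simp only [cd, SubRep.dim]
      omega
    rw [← hL]
    constructor
    · exact fun h => h.2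
    · exact fun h => ⟨h ▸ hβ, h⟩
  rw [h1]
  simp only [T]
  push_cast
  ring
end

section
/- Let Q be a finite quiver over F_q and let U, V be finite-dimensional representations with dimension vectors α_1, α_2 such that Ext^1_Q(U, V) = 0. Then for every dimension vector γ, the number of subrepresentations of U ⊕ V of dimension vector γ satisfies |Gr_γ(U ⊕ V)| = Σ_{γ_1 + γ_2 = γ} q^{⟨γ_1, α_2 − γ_2⟩} · |Gr_{γ_1}(U)| · |Gr_{γ_2}(V)|, where ⟨−,−⟩ is the Euler form of Q. -/
variable (F : Type) [Field F] (Q : FinQuiver)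

variable {F Q}

/-- The direct sum of two representations of `Q`. -/
def QRep.directSum (U V : QRep F Q) : QRep F Q where
  space v := U.space v × V.space v
  map a := (U.map a).prodMap (V.map a)

section vertex

variable {A B : Type} [AddCommGroup A] [Module F A] [AddCommGroup B] [Module F B]

/-- The subspace of `A × B` attached to `φ : L₁ → B / L₂`. -/
def grph (L₁ : Submodule F A) (L₂ : Submodule F B) (φ : L₁ →ₗ[F] B ⧸ L₂) :
    Submodule F (A × B) where
  carrier := {x | ∃ h : x.1 ∈ L₁, φ ⟨x.1, h⟩ = L₂.mkQ x.2}
  add_mem' := by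
    rintro x y ⟨hx, ex⟩ ⟨hy, ey⟩
    refine ⟨L₁.add_mem hx hy, ?_⟩
    have : (⟨(x + y).1, L₁.add_mem hx hy⟩ : L₁) = ⟨x.1, hx⟩ + ⟨y.1, hy⟩ := rfl
    rw [this, map_add, ex, ey, Prod.snd_add, map_add]
  zero_mem' := by
    refine ⟨L₁.zero_mem, ?_⟩
    have : (⟨(0 : A × B).1, L₁.zero_mem⟩ : L₁) = 0 := rfl
    rw [this, map_zero, Prod.snd_zero, map_zero]
  smul_mem' := by
    rintro c x ⟨hx, ex⟩
    refine ⟨L₁.smul_mem c hx, ?_⟩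
    have : (⟨(c • x).1, L₁.smul_mem c hx⟩ : L₁) = c • ⟨x.1, hx⟩ := rfl
    rw [this, map_smul, ex, Prod.smul_snd, map_smul]

theorem mem_grph {L₁ : Submodule F A} {L₂ : Submodule F B} {φ : L₁ →ₗ[F] B ⧸ L₂} {x : A × B} :
    x ∈ grph L₁ L₂ φ ↔ ∃ h : x.1 ∈ L₁, φ ⟨x.1, h⟩ = L₂.mkQ x.2 := Iff.rfl

theorem grph_fst (L₁ : Submodule F A) (L₂ : Submodule F B) (φ : L₁ →ₗ[F] B ⧸ L₂) :
    (grph L₁ L₂ φ).map (LinearMap.fst F A B) = L₁ := by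
  ext u
  constructor
  · rintro ⟨x, ⟨h, _⟩, rfl⟩
    exact h
  · intro h
    obtain ⟨w, hw⟩ := L₂.mkQ_surjective (φ ⟨u, h⟩)
    exact ⟨(u, w), ⟨h, hw.symm⟩, rfl⟩

theorem grph_inr (L₁ : Submodule F A) (L₂ : Submodule F B) (φ : L₁ →ₗ[F] B ⧸ L₂) :
    (grph L₁ L₂ φ).comap (LinearMap.inr F A B) = L₂ := by
  ext w
  have h0 : (⟨0, L₁.zero_mem⟩ : L₁) = 0 := rfl
  constructor
  · rintro ⟨h, e⟩
    have e' : φ ⟨0, L₁.zero_mem⟩ = L₂.mkQ w := e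
    rw [h0, map_zero] at e'
    exact (Submodule.Quotient.mk_eq_zero L₂).1 e'.symm
  · intro h
    refine ⟨L₁.zero_mem, ?_⟩
    change φ ⟨0, L₁.zero_mem⟩ = L₂.mkQ w
    rw [h0, map_zero]
    exact ((Submodule.Quotient.mk_eq_zero L₂).2 h).symm

theorem grph_inj (L₁ : Submodule F A) (L₂ : Submodule F B) {φ ψ : L₁ →ₗ[F] B ⧸ L₂}
    (e : grph L₁ L₂ φ = grph L₁ L₂ ψ) : φ = ψ := by
  ext ⟨u, h⟩
  obtain ⟨w, hw⟩ := L₂.mkQ_surjective (φ ⟨u, h⟩)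
  have : (u, w) ∈ grph L₁ L₂ φ := ⟨h, hw.symm⟩
  rw [e] at this
  obtain ⟨_, h2⟩ := this
  exact hw.symm.trans h2.symm

theorem grph_surj (L : Submodule F (A × B)) (L₁ : Submodule F A) (L₂ : Submodule F B)
    (h₁ : L.map (LinearMap.fst F A B) = L₁) (h₂ : L.comap (LinearMap.inr F A B) = L₂) :
    ∃ φ, grph L₁ L₂ φ = L := by
  have hm : ∀ x : L, ((LinearMap.fst F A B).comp L.subtype) x ∈ L₁ := fun x => by
    rw [← h₁]; exact ⟨x, x.2, rfl⟩
  let p : L →ₗ[F] L₁ := LinearMap.codRestrict L₁ ((LinearMap.fst F A B).comp L.subtype) hm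
  have hp : LinearMap.range p = ⊤ := by
    rw [LinearMap.range_eq_top]
    rintro ⟨u, hu⟩
    have hu' := hu
    rw [← h₁] at hu'
    obtain ⟨x, hx, e⟩ := hu'
    exact ⟨⟨x, hx⟩, Subtype.ext e⟩
  obtain ⟨s, hs⟩ := LinearMap.exists_rightInverse_of_surjective p hp
  have hs1 : ∀ u : L₁, ((s u : L) : A × B).1 = u := fun u =>
    congrArg Subtype.val (LinearMap.congr_fun hs u)
  refine ⟨L₂.mkQ.comp ((LinearMap.snd F A B).comp (L.subtype.comp s)), ?_⟩
  ext ⟨u, w⟩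
  rw [mem_grph]
  have key : ∀ h : u ∈ L₁, ((s ⟨u, h⟩ : L) : A × B).2 - w ∈ L₂ ↔ (u, w) ∈ L := by
    intro h
    rw [← h₂, Submodule.mem_comap]
    have e : LinearMap.inr F A B (((s ⟨u, h⟩ : L) : A × B).2 - w) = (s ⟨u, h⟩ : L) - (u, w) := by
      ext
      · simp [hs1]
      · simp
    rw [e]
    exact L.sub_mem_iff_right (s ⟨u, h⟩).2
  constructor
  · rintro ⟨h, e⟩
    exact (key h).1 ((Submodule.Quotient.eq L₂).1 e)
  · intro hx
    have h : u ∈ L₁ := by rw [← h₁]; exact ⟨(u, w), hx, rfl⟩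
    exact ⟨h, (Submodule.Quotient.eq L₂).2 ((key h).2 hx)⟩

theorem finrank_split [Module.Finite F A] [Module.Finite F B] (L : Submodule F (A × B)) :
    Module.finrank F (L.map (LinearMap.fst F A B)) +
      Module.finrank F (L.comap (LinearMap.inr F A B)) = Module.finrank F L := by
  have h := LinearMap.finrank_range_add_finrank_ker ((LinearMap.fst F A B).comp L.subtype)
  rw [← h, LinearMap.range_comp, Submodule.range_subtype]
  congr 1
  have e1 : (LinearMap.ker ((LinearMap.fst F A B).comp L.subtype)).map L.subtype =
      (L.comap (LinearMap.inr F A B)).map (LinearMap.inr F A B) := by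
    ext ⟨u, w⟩
    constructor
    · rintro ⟨⟨x, hx⟩, h0, e⟩
      have e : x = (u, w) := e
      subst e
      have h0 : u = 0 := h0
      subst h0
      exact ⟨w, hx, rfl⟩
    · rintro ⟨y, hy, e⟩
      exact ⟨⟨_, hy⟩, rfl, e⟩
  rw [LinearEquiv.finrank_eq (Submodule.equivMapOfInjective (LinearMap.inr F A B)
    LinearMap.inr_injective (L.comap (LinearMap.inr F A B))), ← e1]
  exact (LinearEquiv.finrank_eq (Submodule.equivMapOfInjective L.subtype
    L.injective_subtype _)).symm

end vertex

/-- Projection of a subrepresentation to `U`. -/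
def SubRep.pr₁ {U V : QRep F Q} (L : SubRep (U.directSum V)) : SubRep U :=
  ⟨fun v => Submodule.map (LinearMap.fst F (U.space v) (V.space v)) (L.1 v), by
    rintro a _ ⟨_, ⟨x, hx, rfl⟩, rfl⟩
    exact ⟨_, L.2 a ⟨x, hx, rfl⟩, rfl⟩⟩

/-- Intersection of a subrepresentation with `V`. -/
def SubRep.pr₂ {U V : QRep F Q} (L : SubRep (U.directSum V)) : SubRep V :=
  ⟨fun v => Submodule.comap (LinearMap.inr F (U.space v) (V.space v)) (L.1 v), by
    rintro a _ ⟨x, hx, rfl⟩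
    have := L.2 a ⟨_, hx, rfl⟩
    have e : (LinearMap.inr F (U.space (Q.t a)) (V.space (Q.t a))) (V.map a x) =
      ((U.map a).prodMap (V.map a)) (LinearMap.inr F _ _ x) := by simp
    change (LinearMap.inr F (U.space (Q.t a)) (V.space (Q.t a))) (V.map a x) ∈ L.1 (Q.t a)
    rw [e]
    exact this⟩

theorem SubRep.dim_split {U V : QRep F Q} [∀ v, Module.Finite F (U.space v)]
    [∀ v, Module.Finite F (V.space v)] (L : SubRep (U.directSum V)) (v : Q.V) :
    L.pr₁.dim v + L.pr₂.dim v = L.dim v :=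
  finrank_split (A := U.space v) (B := V.space v) (L.1 v)

/-- The differential computing `Hom` and `Ext¹` from `L₁` to `V / L₂`. -/
def diffl {U V : QRep F Q} (L₁ : SubRep U) (L₂ : SubRep V) :
    (∀ v, L₁.1 v →ₗ[F] V.space v ⧸ L₂.1 v) →ₗ[F]
      (∀ a, L₁.1 (Q.s a) →ₗ[F] V.space (Q.t a) ⧸ L₂.1 (Q.t a)) where
  toFun φ a := ((L₂.1 (Q.s a)).mapQ (L₂.1 (Q.t a)) (V.map a)
      (Submodule.map_le_iff_le_comap.1 (L₂.2 a))).comp (φ (Q.s a)) -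
    (φ (Q.t a)).comp ((U.map a).restrict (fun x hx => L₁.2 a ⟨x, hx, rfl⟩))
  map_add' φ ψ := by
    funext a
    ext x
    simp
    abel
  map_smul' c φ := by
    funext a
    ext x
    simp [smul_sub]

theorem diffl_surj {U V : QRep F Q} (L₁ : SubRep U) (L₂ : SubRep V)
    (hext : ∀ g : ∀ a : Q.A, U.space (Q.s a) →ₗ[F] V.space (Q.t a),
      ∃ f : ∀ v, U.space v →ₗ[F] V.space v,
        ∀ a : Q.A, g a = (V.map a).comp (f (Q.s a)) - (f (Q.t a)).comp (U.map a)) :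
    Function.Surjective (diffl L₁ L₂) := by
  intro g
  have hl : ∀ v, ∃ r : U.space v →ₗ[F] L₁.1 v, r.comp (L₁.1 v).subtype = LinearMap.id :=
    fun v => LinearMap.exists_leftInverse_of_injective _ (Submodule.ker_subtype _)
  have hr : ∀ v, ∃ s : (V.space v ⧸ L₂.1 v) →ₗ[F] V.space v,
      (L₂.1 v).mkQ.comp s = LinearMap.id :=
    fun v => LinearMap.exists_rightInverse_of_surjective _ (Submodule.range_mkQ _)
  choose r hr1 using hl
  choose s hs1 using hr
  obtain ⟨f, hf⟩ := hext fun a => (s (Q.t a)).comp ((g a).comp (r (Q.s a)))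
  refine ⟨fun v => (L₂.1 v).mkQ.comp ((f v).comp (L₁.1 v).subtype), ?_⟩
  funext a
  apply LinearMap.ext
  intro x
  have h := LinearMap.congr_fun (hf a) x
  have h1 : r (Q.s a) (x : U.space (Q.s a)) = x := LinearMap.congr_fun (hr1 (Q.s a)) x
  have h2 := LinearMap.congr_fun (hs1 (Q.t a)) (g a x)
  simp only [LinearMap.comp_apply, LinearMap.sub_apply, h1] at h
  simp only [LinearMap.comp_apply, LinearMap.id_apply] at h2
  rw [h, map_sub] at h2
  exact h2

/-- The subrepresentation attached to a morphism `L₁ → V / L₂`. -/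
def glue {U V : QRep F Q} (L₁ : SubRep U) (L₂ : SubRep V)
    (φ : LinearMap.ker (diffl L₁ L₂)) : SubRep (U.directSum V) :=
  ⟨fun v => grph (L₁.1 v) (L₂.1 v) (φ.1 v), by
    rintro a _ ⟨x, ⟨h, e⟩, rfl⟩
    refine ⟨L₁.2 a ⟨x.1, h, rfl⟩, ?_⟩
    have h1 := LinearMap.congr_fun (congrFun (LinearMap.mem_ker.1 φ.2) a) ⟨x.1, h⟩
    have h2 := sub_eq_zero.1 h1
    refine h2.symm.trans ?_
    change Submodule.mapQ _ _ (V.map a)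
      (Submodule.map_le_iff_le_comap.1 (L₂.2 a)) (φ.1 (Q.s a) ⟨x.1, h⟩) = _
    rw [e]
    rfl⟩

theorem glue_bij {U V : QRep F Q} (L₁ : SubRep U) (L₂ : SubRep V) :
    Function.Bijective (fun φ : LinearMap.ker (diffl L₁ L₂) =>
      (⟨glue L₁ L₂ φ, Subtype.ext (funext fun v => grph_fst _ _ _),
        Subtype.ext (funext fun v => grph_inr _ _ _)⟩ :
        {L : SubRep (U.directSum V) // L.pr₁ = L₁ ∧ L.pr₂ = L₂})) := by
  constructor
  · intro φ ψ e
    have e1 : (glue L₁ L₂ φ).1 = (glue L₁ L₂ ψ).1 :=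
      congrArg Subtype.val (congrArg Subtype.val e)
    exact Subtype.ext (funext fun v => grph_inj _ _ (congrFun e1 v))
  · rintro ⟨L, h1, h2⟩
    have hs : ∀ v, ∃ φ, grph (L₁.1 v) (L₂.1 v) φ = L.1 v := fun v =>
      grph_surj _ _ _ (congrFun (congrArg Subtype.val h1) v)
        (congrFun (congrArg Subtype.val h2) v)
    choose φ hφ using hs
    refine ⟨⟨φ, ?_⟩, Subtype.ext (Subtype.ext (funext hφ))⟩
    rw [LinearMap.mem_ker]
    funext a
    apply LinearMap.ext
    rintro ⟨u, hu⟩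
    obtain ⟨w, hw⟩ := (L₂.1 (Q.s a)).mkQ_surjective (φ (Q.s a) ⟨u, hu⟩)
    have hm : (u, w) ∈ grph (L₁.1 (Q.s a)) (L₂.1 (Q.s a)) (φ (Q.s a)) := ⟨hu, hw.symm⟩
    have hm' : ((u, w) : U.space (Q.s a) × V.space (Q.s a)) ∈ L.1 (Q.s a) := hφ (Q.s a) ▸ hm
    have ht : ((U.map a u, V.map a w) : U.space (Q.t a) × V.space (Q.t a)) ∈ L.1 (Q.t a) :=
      L.2 a ⟨_, hm', rfl⟩
    have ht' : ((U.map a u, V.map a w) : U.space (Q.t a) × V.space (Q.t a)) ∈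
      grph (L₁.1 (Q.t a)) (L₂.1 (Q.t a)) (φ (Q.t a)) := (hφ (Q.t a)).symm ▸ ht
    obtain ⟨h3, h4⟩ := ht'
    refine sub_eq_zero.2 ?_
    refine Eq.trans ?_ h4.symm
    change Submodule.mapQ _ _ (V.map a)
      (Submodule.map_le_iff_le_comap.1 (L₂.2 a)) (φ (Q.s a) ⟨u, hu⟩) = _
    rw [← hw]
    rfl

theorem card_fiber [Fintype F] {U V : QRep F Q} [∀ v, Module.Finite F (U.space v)]
    [∀ v, Module.Finite F (V.space v)] (L₁ : SubRep U) (L₂ : SubRep V) (α₂ : Q.V → ℕ)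
    (hV : ∀ v, Module.finrank F (V.space v) = α₂ v)
    (hext : ∀ g : ∀ a : Q.A, U.space (Q.s a) →ₗ[F] V.space (Q.t a),
      ∃ f : ∀ v, U.space v →ₗ[F] V.space v,
        ∀ a : Q.A, g a = (V.map a).comp (f (Q.s a)) - (f (Q.t a)).comp (U.map a)) :
    (Nat.card {L : SubRep (U.directSum V) // L.pr₁ = L₁ ∧ L.pr₂ = L₂} : ℚ) =
      (Fintype.card F : ℚ) ^ (eulerInt (Q := Q) L₁.dim α₂ - eulerInt (Q := Q) L₁.dim L₂.dim) := by
  rw [← Nat.card_eq_of_bijective _ (glue_bij L₁ L₂), Module.natCard_eq_pow_finrank (K := F),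
    Nat.card_eq_fintype_card, Nat.cast_pow, ← zpow_natCast]
  congr 1
  have h := LinearMap.finrank_range_add_finrank_ker (diffl L₁ L₂)
  rw [LinearMap.range_eq_top.2 (diffl_surj L₁ L₂ hext), finrank_top,
    Module.finrank_pi_fintype, Module.finrank_pi_fintype] at h
  simp only [Module.finrank_linearMap] at h
  have hq : ∀ v, (Module.finrank F (V.space v ⧸ L₂.1 v) : ℤ) = α₂ v - L₂.dim v := by
    intro v
    have := Submodule.finrank_quotient_add_finrank (L₂.1 v)
    rw [hV] at this
    rw [← this]
    simp [SubRep.dim]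
  have h' := congrArg (Nat.cast : ℕ → ℤ) h
  push_cast at h'
  simp only [hq, mul_sub, Finset.sum_sub_distrib] at h'
  simp only [eulerInt]
  have hd : ∀ v, Module.finrank F (L₁.1 v) = L₁.dim v := fun v => rfl
  simp only [hd] at h'
  linarith

theorem finite_subRep [Fintype F] (U : QRep F Q) [∀ v, Module.Finite F (U.space v)] :
    Finite (SubRep U) := by
  have : ∀ v, Finite (U.space v) := fun v => Module.finite_of_finite F
  unfold SubRep
  infer_instance

/-- The rigid case of Lemma 7.5 (Caldero–Chapoton-type multiplication formula): if
`Ext¹_Q(U,V) = 0` (expressed by surjectivity of the standard map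
`∏_v Hom(U_v,V_v) → ∏_a Hom(U_{sa},V_{ta})` computing `Ext¹`), then
`|Gr_γ(U ⊕ V)| = Σ_{γ₁+γ₂=γ} q^{⟨γ₁, α₂−γ₂⟩} |Gr_{γ₁}(U)| |Gr_{γ₂}(V)|`. -/
theorem stmt14 [Fintype F] (q : ℕ) (hq : Fintype.card F = q)
    (U V : QRep F Q) [∀ v, Module.Finite F (U.space v)] [∀ v, Module.Finite F (V.space v)]
    (α₁ α₂ : Q.V → ℕ)
    (hU : ∀ v, Module.finrank F (U.space v) = α₁ v)
    (hV : ∀ v, Module.finrank F (V.space v) = α₂ v)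
    (hext : ∀ g : ∀ a : Q.A, U.space (Q.s a) →ₗ[F] V.space (Q.t a),
      ∃ f : ∀ v, U.space v →ₗ[F] V.space v,
        ∀ a : Q.A, g a = (V.map a).comp (f (Q.s a)) - (f (Q.t a)).comp (U.map a))
    (γ : Q.V → ℕ) :
    (Nat.card {L : SubRep (U.directSum V) // ∀ v, L.dim v = γ v} : ℚ) =
      ∑ γ₁ ∈ Finset.Iic γ,
        (q : ℚ) ^ (eulerInt (Q := Q) γ₁ α₂ - eulerInt (Q := Q) γ₁ (γ - γ₁)) *
          (Nat.card {L : SubRep U // ∀ v, L.dim v = γ₁ v} : ℚ) *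
          (Nat.card {L : SubRep V // ∀ v, L.dim v = (γ - γ₁) v} : ℚ) := by
  classical
  have : ∀ v, Module.Finite F ((U.directSum V).space v) := fun v =>
    inferInstanceAs (Module.Finite F (U.space v × V.space v))
  have := finite_subRep U
  have := finite_subRep V
  have := finite_subRep (U.directSum V)
  have := Fintype.ofFinite (SubRep U)
  have := Fintype.ofFinite (SubRep V)
  have := Fintype.ofFinite (SubRep (U.directSum V))
  simp only [Nat.card_eq_fintype_card, Fintype.card_subtype]
  rw [Finset.card_eq_sum_card_fiberwise (f := fun L => L.pr₁.dim) (t := Finset.Iic γ), Nat.cast_sum]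
  · refine Finset.sum_congr rfl fun γ₁ hγ => ?_
    rw [Finset.mem_Iic] at hγ
    rw [Finset.card_eq_sum_card_fiberwise (f := fun L => (L.pr₁, L.pr₂))
      (t := (Finset.univ.filter fun L : SubRep U => ∀ v, L.dim v = γ₁ v) ×ˢ
        (Finset.univ.filter fun L : SubRep V => ∀ v, L.dim v = (γ - γ₁) v)), Nat.cast_sum]
    · rw [Finset.sum_congr rfl (g := fun _ =>
        (q : ℚ) ^ (eulerInt (Q := Q) γ₁ α₂ - eulerInt (Q := Q) γ₁ (γ - γ₁)))]
      · rw [Finset.sum_const, Finset.card_product, nsmul_eq_mul]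
        push_cast
        ring
      · rintro ⟨L₁, L₂⟩ hL
        simp only [Finset.mem_product, Finset.mem_filter, Finset.mem_univ, true_and] at hL
        obtain ⟨h1, h2⟩ := hL
        have e1 : L₁.dim = γ₁ := funext h1
        have e2 : L₂.dim = γ - γ₁ := funext h2
        have := card_fiber L₁ L₂ α₂ hV hext
        rw [e1, e2, hq, Nat.card_eq_fintype_card, Fintype.card_subtype] at this
        rw [← this]
        congr 2
        ext L
        simp only [Finset.mem_filter, Finset.mem_univ, true_and, Prod.mk.injEq]
        constructor
        · exact fun h => h.2
        · rintro ⟨rfl, rfl⟩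
          refine ⟨⟨fun v => ?_, e1⟩, rfl, rfl⟩
          rw [← L.dim_split v, h1, h2]
          exact Nat.add_sub_of_le (hγ v)
    · intro L hL
      simp only [Finset.coe_filter, Finset.mem_filter, Finset.mem_univ, true_and,
        Set.mem_ofPred_eq, Finset.coe_product, Set.mem_prod] at hL ⊢
      obtain ⟨h1, h2⟩ := hL
      refine ⟨fun v => congrFun h2 v, fun v => ?_⟩
      have h3 := L.dim_split v
      have h4 := congrFun h2 v
      rw [h1 v] at h3
      simp only [Pi.sub_apply]
      omega
  · intro L hL
    simp only [Finset.coe_filter, Finset.mem_univ, true_and, Set.mem_ofPred_eq,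
      Finset.coe_Iic, Set.mem_Iic] at hL ⊢
    intro v
    have h3 := L.dim_split v
    rw [hL v] at h3
    dsimp only
    omega
end

section
/- Let Q be a finite quiver over F_q and for each dimension vector α let r_α(Q) = |Rep_α(Q)|/|GL_α(F_q)|. Then for dimension vectors α and β (for the two copies of Q in A_2 ⊗ Q), the normalized count of representations of the commutative-square algebra kA_2 ⊗ kQ of dimension (α, β) satisfies r_{(α,β)}(A_2(Q)) = Σ_{β = β_1 + β_2} q^{−⟨β_1,β_2⟩} · q^{−⟨β_2, α−β_2⟩} · r_{β_1}(Q) · r_{β_2}(Q) · r_{α−β_2}(Q), where ⟨−,−⟩ is the Euler form of Q. Here r_{(α,β)}(A_2(Q)) counts triples (M, N, f) with M ∈ Rep_α(Q), N ∈ Rep_β(Q), f ∈ Hom_Q(M, N), divided by |GL_α||GL_β|. -/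
variable (F : Type) [Field F] (Q : FinQuiver)

variable {F Q}

open scoped Classical

/-- The normalized count `r_γ(Q) = |Rep_γ(Q)|/|GL_γ|`. -/
noncomputable def rQ [Fintype F] (γ : Q.V → ℕ) : ℚ :=
  (Nat.card (RepSpace (F := F) (Q := Q) γ) : ℚ) / glCard (F := F) γ

theorem aux_kerdim {F V1 V2 W1 W2 : Type} [Field F] [AddCommGroup V1] [AddCommGroup V2]
    [AddCommGroup W1] [AddCommGroup W2] [Module F V1] [Module F V2] [Module F W1] [Module F W2]
    [FiniteDimensional F V1] [FiniteDimensional F V2] [FiniteDimensional F W1]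
    [FiniteDimensional F W2] (f : V1 →ₗ[F] W1) (g : V2 →ₗ[F] W2) :
    ∃ S : Submodule F ((V1 →ₗ[F] V2) × (W1 →ₗ[F] W2)),
      (∀ p, p ∈ S ↔ g.comp p.1 = p.2.comp f) ∧
      Module.finrank F S + Module.finrank F V1 * Module.finrank F W2 =
        Module.finrank F V1 * Module.finrank F V2 + Module.finrank F W1 * Module.finrank F W2 +
        (Module.finrank F V1 - Module.finrank F (LinearMap.range f)) *
        (Module.finrank F W2 - Module.finrank F (LinearMap.range g)) := by
  let Φ : ((V1 →ₗ[F] V2) × (W1 →ₗ[F] W2)) →ₗ[F] (V1 →ₗ[F] W2) :=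
    { toFun := fun p => g.comp p.1 - p.2.comp f
      map_add' := by intro x y; ext v; simp; abel
      map_smul' := by intro c x; ext v; simp [smul_sub] }
  let Ψ : (V1 →ₗ[F] W2) →ₗ[F] (LinearMap.ker f →ₗ[F] W2 ⧸ LinearMap.range g) :=
    { toFun := fun h => ((LinearMap.range g).mkQ.comp h).comp (LinearMap.ker f).subtype
      map_add' := by intro x y; ext v; simp
      map_smul' := by intro c x; ext v; simp }
  have hΨ : Function.Surjective Ψ := by
    intro h
    obtain ⟨h1, hh1⟩ := LinearMap.exists_extend h
    obtain ⟨h2, hh2⟩ := Module.projective_lifting_property (LinearMap.range g).mkQ h1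
      (Submodule.mkQ_surjective _)
    refine ⟨h2, ?_⟩
    change ((LinearMap.range g).mkQ.comp h2).comp (LinearMap.ker f).subtype = h
    rw [hh2, hh1]
  have hex : LinearMap.range Φ = LinearMap.ker Ψ := by
    apply le_antisymm
    · rintro _ ⟨p, rfl⟩
      rw [LinearMap.mem_ker]
      ext ⟨v, hv⟩
      have hv' : f v = 0 := hv
      change (LinearMap.range g).mkQ (g (p.1 v) - p.2 (f v)) = 0
      rw [hv', map_zero, sub_zero]
      simp
    · intro h hh
      rw [LinearMap.mem_ker] at hh
      have hk : ∀ v, f v = 0 → (LinearMap.range g).mkQ (h v) = 0 := by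
        intro v hv
        exact LinearMap.congr_fun hh (⟨v, hv⟩ : LinearMap.ker f)
      have hle : LinearMap.ker f ≤ LinearMap.ker ((LinearMap.range g).mkQ.comp h) := by
        intro v hv; exact hk v hv
      let h3 : LinearMap.range f →ₗ[F] W2 ⧸ LinearMap.range g :=
        ((LinearMap.ker f).liftQ _ hle).comp f.quotKerEquivRange.symm.toLinearMap
      obtain ⟨h4, hh4⟩ := LinearMap.exists_extend h3
      obtain ⟨N, hN⟩ := Module.projective_lifting_property (LinearMap.range g).mkQ h4
        (Submodule.mkQ_surjective _)
      have key : ∀ v, (LinearMap.range g).mkQ (N (f v)) = (LinearMap.range g).mkQ (h v) := by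
        intro v
        have e1 := LinearMap.congr_fun hN (f v)
        have e2 := LinearMap.congr_fun hh4 (⟨f v, v, rfl⟩ : LinearMap.range f)
        have e3 : f.quotKerEquivRange.symm ⟨f v, v, rfl⟩ = (LinearMap.ker f).mkQ v := by
          rw [LinearEquiv.symm_apply_eq]; ext; simp
        simp only [LinearMap.comp_apply] at e1
        rw [e1]
        refine e2.trans ?_
        simp only [h3, LinearMap.comp_apply, LinearEquiv.coe_coe]
        rw [e3]; simp
      have hr : ∀ v, (h + N.comp f - (2:F) • N.comp f) v ∈ LinearMap.range g := by
        intro v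
        rw [← Submodule.Quotient.mk_eq_zero]
        have := key v
        simp only [Submodule.mkQ_apply] at this
        simp [two_smul, this]
      obtain ⟨M, hM⟩ := Module.projective_lifting_property g.rangeRestrict
        (LinearMap.codRestrict _ _ hr) g.surjective_rangeRestrict
      refine ⟨(M, -N), ?_⟩
      apply LinearMap.ext
      intro v
      have : g (M v) = (h + N.comp f - (2:F) • N.comp f) v :=
        congrArg Subtype.val (LinearMap.congr_fun hM v)
      change g (M v) - (-N) (f v) = h v
      rw [this]; simp [two_smul]
  refine ⟨LinearMap.ker Φ, ?_, ?_⟩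
  · intro p
    rw [LinearMap.mem_ker]
    exact sub_eq_zero
  · have r1 := LinearMap.finrank_range_add_finrank_ker Φ
    have r2 := LinearMap.finrank_range_add_finrank_ker Ψ
    rw [LinearMap.range_eq_top.mpr hΨ, finrank_top, Module.finrank_linearMap,
      Module.finrank_linearMap, Submodule.finrank_quotient] at r2
    have r3 := LinearMap.finrank_range_add_finrank_ker f
    rw [hex, Module.finrank_prod, Module.finrank_linearMap, Module.finrank_linearMap] at r1
    have : Module.finrank F (LinearMap.ker f) =
      Module.finrank F V1 - Module.finrank F (LinearMap.range f) := by omega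
    rw [this] at r2
    omega

theorem aux_comm {F : Type} [Field F] [Fintype F] {a b c d : ℕ}
    (f : (Fin a → F) →ₗ[F] (Fin b → F)) (g : (Fin c → F) →ₗ[F] (Fin d → F)) :
    Nat.card {p : ((Fin a → F) →ₗ[F] (Fin c → F)) × ((Fin b → F) →ₗ[F] (Fin d → F)) //
      g.comp p.1 = p.2.comp f} * Fintype.card F ^ (a * d) =
    Fintype.card F ^ (a * c + b * d + (a - Module.finrank F (LinearMap.range f)) *
        (d - Module.finrank F (LinearMap.range g))) := by
  obtain ⟨S, hS, hd⟩ := aux_kerdim f g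
  have e : Nat.card {p : ((Fin a → F) →ₗ[F] (Fin c → F)) × ((Fin b → F) →ₗ[F] (Fin d → F)) //
      g.comp p.1 = p.2.comp f} = Nat.card S :=
    Nat.card_congr (Equiv.subtypeEquivRight fun p => (hS p).symm)
  simp only [Module.finrank_fintype_fun_eq_card, Fintype.card_fin] at hd
  rw [e, Module.natCard_eq_pow_finrank (K := F), Nat.card_eq_fintype_card, ← pow_add, hd]

abbrev RkMaps (F : Type) [Field F] (a b r : ℕ) :=
  {f : (Fin a → F) →ₗ[F] (Fin b → F) // Module.finrank F (LinearMap.range f) = r}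

theorem aux_transpose (F : Type) [Field F] (a b r : ℕ) :
    Nat.card (RkMaps F a b r) = Nat.card (RkMaps F b a r) := by
  refine Nat.card_congr (Equiv.subtypeEquiv
    (LinearMap.toMatrix'.toEquiv.trans ((Matrix.transposeAddEquiv _ _ F).toEquiv.trans
      Matrix.toLin'.toEquiv)) ?_)
  intro f
  have h1 : Module.finrank F (LinearMap.range f) = (LinearMap.toMatrix' f).rank := by
    rw [Matrix.rank, ← Matrix.toLin'_apply', Matrix.toLin'_toMatrix']
  rw [h1, ← Matrix.rank_transpose, Matrix.rank, ← Matrix.toLin'_apply']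
  rfl

theorem aux_inj (F : Type) [Field F] [Fintype F] (b r : ℕ) (h : r ≤ b) :
    Nat.card (RkMaps F r b r) = ∏ i : Fin r, (Fintype.card F ^ b - Fintype.card F ^ i.val) := by
  have := card_linearIndependent (K := F) (V := Fin b → F) (k := r) (by simpa using h)
  rw [Module.finrank_fintype_fun_eq_card, Fintype.card_fin] at this
  rw [← this]
  refine (Nat.card_congr (Equiv.subtypeEquiv ((Pi.basisFun F (Fin r)).constr F).toEquiv ?_)).symm
  intro s
  rw [linearIndependent_iff_card_eq_finrank_span, Fintype.card_fin, Set.finrank, eq_comm]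
  have : LinearMap.range (((Pi.basisFun F (Fin r)).constr F) s) =
    Submodule.span F (Set.range s) := Module.Basis.constr_range _ _
  rw [← this]; rfl

theorem aux_prod (q b r : ℕ) (h : r ≤ b) :
    (∏ i : Fin r, (q ^ b - q ^ i.val)) * q ^ (r * (b - r)) *
      (∏ i : Fin (b - r), (q ^ (b - r) - q ^ i.val)) = ∏ i : Fin b, (q ^ b - q ^ i.val) := by
  obtain ⟨c, rfl⟩ := Nat.exists_eq_add_of_le h
  rw [Nat.add_sub_cancel_left, Fin.prod_univ_add, mul_assoc]
  congr 1
  rw [pow_mul]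
  have : (q ^ r) ^ c = ∏ i : Fin c, q ^ r := by simp
  rw [this, ← Finset.prod_mul_distrib]
  refine Finset.prod_congr rfl fun i _ => ?_
  rw [Nat.mul_sub, ← pow_add, ← pow_add]; simp

theorem aux_inj' (F : Type) [Field F] [Fintype F] (b r : ℕ) (h : r ≤ b) :
    Nat.card (RkMaps F r b r) * Fintype.card F ^ (r * (b - r)) * Nat.card (GL (Fin (b - r)) F)
      = Nat.card (GL (Fin b) F) := by
  rw [aux_inj F b r h, Matrix.card_GL_field, Matrix.card_GL_field, aux_prod _ _ _ h]

theorem aux_equivcard {F : Type} [Field F] {W : Type} [AddCommGroup W] [Module F W]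
    [FiniteDimensional F W] (r : ℕ) (h : Module.finrank F W = r) :
    Nat.card ((Fin r → F) ≃ₗ[F] W) = Nat.card (GL (Fin r) F) := by
  have e0 : (Fin r → F) ≃ₗ[F] W := LinearEquiv.ofFinrankEq _ _ (by simp [h])
  refine Nat.card_congr (Equiv.trans ?_ ((Matrix.GeneralLinearGroup.toLin (n := Fin r)
    (R := F)).toEquiv.trans
      (LinearMap.GeneralLinearGroup.generalLinearEquiv F (Fin r → F)).toEquiv).symm)
  exact
    { toFun := fun e => e.trans e0.symm
      invFun := fun e => e.trans e0
      left_inv := fun e => by ext; simp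
      right_inv := fun e => by ext; simp }

theorem aux_factor (F : Type) [Field F] [Fintype F] (a b r : ℕ) :
    Nat.card (RkMaps F a b r) * Nat.card (GL (Fin r) F) =
      Nat.card (RkMaps F r b r) * Nat.card (RkMaps F a r r) := by
  have hfin : Finite (RkMaps F a b r) := by
    have : Finite ((Fin a → F) →ₗ[F] (Fin b → F)) := Module.finite_of_finite F
    infer_instance
  have e : Nat.card (Σ f : RkMaps F a b r, ((Fin r → F) ≃ₗ[F] LinearMap.range f.1)) =
      Nat.card (RkMaps F a b r) * Nat.card (GL (Fin r) F) := by
    have := Fintype.ofFinite (RkMaps F a b r)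
    have : ∀ f : RkMaps F a b r, Finite ((Fin r → F) ≃ₗ[F] LinearMap.range f.1) := fun f =>
      DFunLike.finite _
    rw [Nat.card_sigma, Finset.sum_congr rfl (fun f _ => aux_equivcard r f.2)]
    simp
  rw [← e, ← Nat.card_prod]
  have hp : ∀ x : (Σ f : RkMaps F a b r, ((Fin r → F) ≃ₗ[F] LinearMap.range f.1)),
      Module.finrank F (LinearMap.range
        ((LinearMap.range x.1.1).subtype.comp x.2.toLinearMap)) = r := by
    intro x
    rw [LinearMap.finrank_range_of_inj]
    · simp
    · exact Subtype.val_injective.comp x.2.injective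
  have hp' : ∀ x : (Σ f : RkMaps F a b r, ((Fin r → F) ≃ₗ[F] LinearMap.range f.1)),
      Module.finrank F (LinearMap.range
        (x.2.symm.toLinearMap.comp x.1.1.rangeRestrict)) = r := by
    intro x
    rw [LinearMap.range_eq_top.mpr]
    · simp
    · exact x.2.symm.surjective.comp x.1.1.surjective_rangeRestrict
  refine Nat.card_eq_of_bijective (fun x => (⟨_, hp x⟩, ⟨_, hp' x⟩)) ⟨?_, ?_⟩
  · rintro ⟨⟨f, hf⟩, e⟩ ⟨⟨f', hf'⟩, e'⟩ hxy
    simp only [Prod.mk.injEq, Subtype.mk.injEq] at hxy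
    obtain ⟨h1, h2⟩ := hxy
    have hff : f = f' := by
      apply LinearMap.ext
      intro v
      have := LinearMap.congr_fun h1 (e.symm (f.rangeRestrict v))
      have h3 := LinearMap.congr_fun h2 v
      simp only [LinearMap.comp_apply, LinearEquiv.coe_coe] at this h3
      rw [LinearEquiv.apply_symm_apply, h3, LinearEquiv.apply_symm_apply] at this
      exact this
    subst hff
    have : e = e' := by
      ext1 v
      exact Subtype.ext (LinearMap.congr_fun h1 v)
    rw [this]
  · rintro ⟨⟨i, hi⟩, ⟨p, hp⟩⟩
    have hps : LinearMap.range p = ⊤ :=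
      Submodule.eq_top_of_finrank_eq (by simp [hp])
    have hinj : Function.Injective i := by
      have := LinearMap.finrank_range_add_finrank_ker i
      rw [hi, Module.finrank_fintype_fun_eq_card, Fintype.card_fin] at this
      rw [← LinearMap.ker_eq_bot]
      exact Submodule.finrank_eq_zero.mp (by omega)
    have hr : LinearMap.range (i.comp p) = LinearMap.range i :=
      LinearMap.range_comp_of_range_eq_top _ hps
    let e : (Fin r → F) ≃ₗ[F] LinearMap.range (i.comp p) :=
      (LinearEquiv.ofInjective i hinj).trans (LinearEquiv.ofEq _ _ hr.symm)
    have he : ∀ v, (e v : Fin b → F) = i v := fun v => rfl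
    refine ⟨⟨⟨i.comp p, by rw [hr, hi]⟩, e⟩, ?_⟩
    simp only [Prod.mk.injEq, Subtype.mk.injEq]
    constructor
    · ext1; rfl
    · apply LinearMap.ext
      intro v
      simp only [LinearMap.comp_apply, LinearEquiv.coe_coe]
      rw [LinearEquiv.symm_apply_eq]
      exact Subtype.ext rfl

theorem aux_rk (F : Type) [Field F] [Fintype F] (a b r : ℕ) (ha : r ≤ a) (hb : r ≤ b) :
    Nat.card (RkMaps F a b r) * (Fintype.card F ^ ((b - r) * r + r * (a - r)) *
      Nat.card (GL (Fin (b - r)) F) * Nat.card (GL (Fin r) F) * Nat.card (GL (Fin (a - r)) F)) =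
      Nat.card (GL (Fin a) F) * Nat.card (GL (Fin b) F) := by
  rw [← aux_inj' F a r ha, ← aux_inj' F b r hb]
  have := aux_factor F a b r
  rw [aux_transpose F a r r] at this
  rw [pow_add, mul_comm (b - r) r]
  linear_combination (Fintype.card F ^ (r * (b - r)) * Fintype.card F ^ (r * (a - r)) *
      Nat.card (GL (Fin (b - r)) F) * Nat.card (GL (Fin (a - r)) F)) * this

/-- The counting formula for `A₂(Q) = kA₂ ⊗ kQ`: representations of dimension `(α, β)`
are triples `(M, N, f)` with `M ∈ Rep_α(Q)`, `N ∈ Rep_β(Q)`, `f ∈ Hom_Q(M,N)`, and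
`r_{(α,β)}(A₂(Q)) = Σ_{β = β₁ + β₂} q^{−⟨β₁,β₂⟩} q^{−⟨β₂,α−β₂⟩} r_{β₁}(Q) r_{β₂}(Q) r_{α−β₂}(Q)`,
where `β₂` runs over the possible dimension vectors of the image of `f` (so `β₂ ≤ α`). -/
theorem stmt17 [Fintype F] (q : ℕ) (hq : Fintype.card F = q) (α β : Q.V → ℕ) :
    (Nat.card ((M : RepSpace (F := F) (Q := Q) α) ×
        (N : RepSpace (F := F) (Q := Q) β) × HomRep M.toQRep N.toQRep) : ℚ) /
      (glCard (F := F) (Q := Q) α * glCard (F := F) (Q := Q) β) =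
    ∑ β₂ ∈ Finset.Iic β,
      if β₂ ≤ α then
        (q : ℚ) ^ (-(eulerInt (Q := Q) (β - β₂) β₂) - eulerInt (Q := Q) β₂ (α - β₂)) *
          rQ (F := F) (Q := Q) (β - β₂) * rQ (F := F) (Q := Q) β₂ *
          rQ (F := F) (Q := Q) (α - β₂)
      else 0 := by
  subst hq
  set q := Fintype.card F with hqdef
  have hq0 : (q : ℚ) ≠ 0 := by
    have : 0 < q := Fintype.card_pos
    positivity
  have hfinL : ∀ a b : ℕ, Finite ((Fin a → F) →ₗ[F] (Fin b → F)) :=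
    fun a b => Module.finite_of_finite F
  let H := ∀ v : Q.V, (Fin (α v) → F) →ₗ[F] (Fin (β v) → F)
  have hfH : Finite H := Pi.finite
  letI : Fintype H := Fintype.ofFinite H
  let ρ : H → Q.V → ℕ := fun f v => Module.finrank F (LinearMap.range (f v))
  have hρα : ∀ f, ρ f ≤ α := by
    intro f v
    have := LinearMap.finrank_range_le (f v)
    simpa using this
  have hρβ : ∀ f, ρ f ≤ β := by
    intro f v
    have := Submodule.finrank_le (LinearMap.range (f v))
    simpa using this
  let P : H → Q.A → Type := fun f a =>
    {p : ((Fin (α (Q.s a)) → F) →ₗ[F] (Fin (α (Q.t a)) → F)) ×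
      ((Fin (β (Q.s a)) → F) →ₗ[F] (Fin (β (Q.t a)) → F)) //
      (f (Q.t a)).comp p.1 = p.2.comp (f (Q.s a))}
  have hfP : ∀ f a, Finite (P f a) := fun f a => Subtype.finite
  let E : ((M : RepSpace (F := F) (Q := Q) α) ×
        (N : RepSpace (F := F) (Q := Q) β) × HomRep M.toQRep N.toQRep) ≃
      (Σ f : H, ∀ a, P f a) :=
    { toFun := fun x => ⟨x.2.2.1, fun a => ⟨(x.1 a, x.2.1 a), x.2.2.2 a⟩⟩
      invFun := fun y => ⟨fun a => (y.2 a).1.1, fun a => (y.2 a).1.2, y.1, fun a => (y.2 a).2⟩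
      left_inv := fun x => rfl
      right_inv := fun y => rfl }
  let y : (Q.V → ℕ) → Q.A → ℕ := fun r a =>
    (β - r) (Q.s a) * r (Q.t a) + r (Q.s a) * (α - r) (Q.t a)
  let x : (Q.V → ℕ) → Q.V → ℕ := fun r v => (β - r) v * r v + r v * (α - r) v
  let z : (Q.V → ℕ) → Q.A → ℕ := fun r a => r (Q.s a) * r (Q.t a)
  have hP : ∀ f a, Nat.card (P f a) = q ^ (y (ρ f) a + z (β - ρ f) a + z (ρ f) a +
      z (α - ρ f) a) := by
    intro f a
    have h := aux_comm (f (Q.s a)) (f (Q.t a))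
    have hpos : 0 < q ^ (α (Q.s a) * β (Q.t a)) := pow_pos Fintype.card_pos _
    refine Nat.eq_of_mul_eq_mul_right hpos (h.trans ?_)
    rw [← hqdef, ← pow_add]
    congr 1
    have h1 := hρα f (Q.s a)
    have h2 := hρα f (Q.t a)
    have h3 := hρβ f (Q.s a)
    have h4 := hρβ f (Q.t a)
    simp only [y, z, Pi.sub_apply]
    change _ * _ + _ * _ + (_ - ρ f (Q.s a)) * (_ - ρ f (Q.t a)) = _
    zify [h1, h2, h3, h4]
    ring
  have hcardRep : ∀ r : Q.V → ℕ, Nat.card (RepSpace (F := F) (Q := Q) r) = ∏ a, q ^ z r a := by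
    intro r
    unfold RepSpace
    rw [Nat.card_pi]
    refine Finset.prod_congr rfl fun a _ => ?_
    rw [Module.natCard_eq_pow_finrank (K := F), Nat.card_eq_fintype_card, Module.finrank_linearMap]
    simp [z, hqdef]
  have hgl : ∀ r : Q.V → ℕ, glCard (F := F) (Q := Q) r ≠ 0 := by
    intro r
    unfold glCard
    refine Finset.prod_ne_zero_iff.mpr fun v _ => ?_
    exact Nat.cast_ne_zero.mpr Nat.card_pos.ne'
  let G : (Q.V → ℕ) → ℕ := fun r => ∏ a, q ^ (y r a + z (β - r) a + z r a + z (α - r) a)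
  have hcount : Nat.card ((M : RepSpace (F := F) (Q := Q) α) ×
        (N : RepSpace (F := F) (Q := Q) β) × HomRep M.toQRep N.toQRep) =
      ∑ r ∈ Finset.Iic β, Nat.card {f : H // ρ f = r} * G r := by
    rw [Nat.card_congr E, Nat.card_sigma,
      ← Finset.sum_fiberwise_of_maps_to (s := Finset.univ) (t := Finset.Iic β) (g := ρ)
        (fun f _ => Finset.mem_Iic.mpr (hρβ f))]
    refine Finset.sum_congr rfl fun r _ => ?_
    rw [Finset.sum_congr rfl (g := fun _ => G r)]
    · rw [Finset.sum_const, smul_eq_mul, Nat.card_eq_fintype_card, Fintype.card_subtype]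
    · intro f hf
      rw [Nat.card_pi]
      have : ρ f = r := (Finset.mem_filter.mp hf).2
      refine Finset.prod_congr rfl fun a _ => ?_
      rw [hP, this]
  rw [hcount, Nat.cast_sum, Finset.sum_div]
  refine Finset.sum_congr rfl fun r hr => ?_
  have hrβ : r ≤ β := Finset.mem_Iic.mp hr
  split_ifs with hrα
  · have hfib : Nat.card {f : H // ρ f = r} = ∏ v, Nat.card (RkMaps F (α v) (β v) (r v)) := by
      rw [← Nat.card_pi]
      refine Nat.card_congr (Equiv.trans (Equiv.subtypeEquivRight fun f => ?_)
        Equiv.subtypePiEquivPi)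
      exact funext_iff
    have hvert : (Nat.card {f : H // ρ f = r} : ℚ) * ((∏ v, (q : ℚ) ^ x r v) *
        glCard (F := F) (Q := Q) (β - r) * glCard (F := F) (Q := Q) r *
        glCard (F := F) (Q := Q) (α - r)) =
        glCard (F := F) (Q := Q) α * glCard (F := F) (Q := Q) β := by
      rw [hfib]
      unfold glCard
      rw [Nat.cast_prod]
      simp only [← Finset.prod_mul_distrib]
      refine Finset.prod_congr rfl fun v _ => ?_
      exact_mod_cast aux_rk F (α v) (β v) (r v) (hrα v) (hrβ v)
    have hexp : (q : ℚ) ^ (-(eulerInt (Q := Q) (β - r) r) - eulerInt (Q := Q) r (α - r)) =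
        (∏ a, (q : ℚ) ^ y r a) / ∏ v, (q : ℚ) ^ x r v := by
      have : -(eulerInt (Q := Q) (β - r) r) - eulerInt (Q := Q) r (α - r) =
          ((∑ a, y r a : ℕ) : ℤ) - ((∑ v, x r v : ℕ) : ℤ) := by
        simp only [eulerInt, x, y]
        push_cast
        rw [Finset.sum_add_distrib, Finset.sum_add_distrib]
        ring
      rw [this, zpow_sub₀ hq0, zpow_natCast, zpow_natCast, Finset.prod_pow_eq_pow_sum,
        Finset.prod_pow_eq_pow_sum]
    have hG : (G r : ℚ) = (∏ a, (q : ℚ) ^ y r a) * (∏ a, (q : ℚ) ^ z (β - r) a) *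
        (∏ a, (q : ℚ) ^ z r a) * (∏ a, (q : ℚ) ^ z (α - r) a) := by
      simp only [G, ← Finset.prod_mul_distrib, ← pow_add]
      push_cast
      rfl
    have hX : (∏ v, (q : ℚ) ^ x r v) ≠ 0 :=
      Finset.prod_ne_zero_iff.mpr fun v _ => pow_ne_zero _ hq0
    rw [hexp, Nat.cast_mul, hG]
    unfold rQ
    rw [hcardRep, hcardRep, hcardRep, ← hvert]
    push_cast
    have g1 := hgl (β - r)
    have g2 := hgl r
    have g3 := hgl (α - r)
    have hn : (Nat.card {f : H // ρ f = r} : ℚ) ≠ 0 := by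
      intro h0
      rw [h0, zero_mul] at hvert
      exact mul_ne_zero (hgl α) (hgl β) hvert.symm
    field_simp
  · have : IsEmpty {f : H // ρ f = r} := ⟨fun f => hrα (f.2 ▸ hρα f.1)⟩
    simp
end
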